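/- Let H be a fixed graph and let p_- = (ln n − ln ln n)/m_1(H). Then with probability tending to 1 as n → ∞, the number of isolated vertices in G(H,n,p_-) is at most 2 ln n. -/

import Mathlib

open Filter

namespace RandomMotif

/-- `G` is a *copy* of `H` in the complete graph on `Fin n`: the image of `H`
under an injection of its vertices into `Fin n`. -/
def IsCopy {k n : ℕ} (H : SimpleGraph (Fin k)) (G : SimpleGraph (Fin n)) : Prop :=
  ∃ f : Fin k ↪ Fin n, G = H.map f

/-- The type of copies of `H` in `K_n`. -/
abbrev Copy {k : ℕ} (H : SimpleGraph (Fin k)) (n : ℕ) : Type :=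
  {G : SimpleGraph (Fin n) // IsCopy H G}

/-- The graph spanned by the selected copies. -/
noncomputable def graphOf {k n : ℕ} {H : SimpleGraph (Fin k)} (ω : Copy H n → Bool) :
    SimpleGraph (Fin n) :=
  ⨆ c : Copy H n, if ω c then c.1 else ⊥

open Classical in
/-- The probability, in the binomial random motif model `G(H,n,p)` (each copy of `H`
in `K_n` is included independently with probability `p`), of the event `P` on the
family of selected copies. -/
noncomputable def selProb {k : ℕ} (H : SimpleGraph (Fin k)) (n : ℕ) (p : ℝ)
    (P : (Copy H n → Bool) → Prop) : ℝ :=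
  ∑ ω : Copy H n → Bool,
    (∏ c : Copy H n, if ω c then p else 1 - p) * (if P ω then 1 else 0)

/-- The probability that `G(H,n,p)` satisfies the graph predicate `Q`. -/
noncomputable def motifProb {k : ℕ} (H : SimpleGraph (Fin k)) (n : ℕ) (p : ℝ)
    (Q : SimpleGraph (Fin n) → Prop) : ℝ :=
  selProb H n p (fun ω => Q (graphOf ω))

/-- `mr H n r` is the number of copies of `H` in `K_n` whose vertex set meets
`[r] = {0,…,r-1}`. -/
noncomputable def mr {k : ℕ} (H : SimpleGraph (Fin k)) (n r : ℕ) : ℕ :=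
  Nat.card {G : SimpleGraph (Fin n) // IsCopy H G ∧ ∃ v ∈ G.support, (v : ℕ) < r}

/-- The minimum degree `δ(H)`. -/
noncomputable def minDeg {k : ℕ} (H : SimpleGraph (Fin k)) : ℕ :=
  ⨅ v, (H.neighborSet v).ncard

/-- `δ_d(H) = ⌈d / δ(H)⌉ - 1`. -/
noncomputable def deltad {k : ℕ} (H : SimpleGraph (Fin k)) (d : ℕ) : ℕ :=
  ⌈(d : ℝ) / (minDeg H : ℝ)⌉₊ - 1

/-- `p_d^-(H) = (ln n + δ_d(H) ln ln n - x(n)) / m_1(H)`, where `x` is a fixed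
function with `1 ≪ x(n) ≪ ln ln n`. -/
noncomputable def pMinus {k : ℕ} (H : SimpleGraph (Fin k)) (d : ℕ) (x : ℕ → ℝ) (n : ℕ) : ℝ :=
  (Real.log n + (deltad H d) * Real.log (Real.log n) - x n) / (mr H n 1)

/-- `p_d^+(H) = (ln n + δ_d(H) ln ln n + x(n)) / m_1(H)`, where `x` is a fixed
function with `1 ≪ x(n) ≪ ln ln n`. -/
noncomputable def pPlus {k : ℕ} (H : SimpleGraph (Fin k)) (d : ℕ) (x : ℕ → ℝ) (n : ℕ) : ℝ :=
  (Real.log n + (deltad H d) * Real.log (Real.log n) + x n) / (mr H n 1)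

open Classical in
/-- The copies of `H` that contain the vertex `v`. -/
noncomputable def copiesAt {k : ℕ} (H : SimpleGraph (Fin k)) (n : ℕ) (v : Fin n) :
    Finset (Copy H n) :=
  Finset.univ.filter fun c => v ∈ c.1.support

lemma mem_copiesAt {k n : ℕ} {H : SimpleGraph (Fin k)} {v : Fin n} {c : Copy H n} :
    c ∈ copiesAt H n v ↔ v ∈ c.1.support := by
  simp [copiesAt]

lemma mem_support_map {V W : Type*} (G : SimpleGraph V) (f : V ↪ W) (w : W) :
    w ∈ (G.map f).support ↔ ∃ v ∈ G.support, f v = w := by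
  simp only [SimpleGraph.mem_support, SimpleGraph.map_adj]
  constructor
  · rintro ⟨x, a, b, h, rfl, rfl⟩
    exact ⟨a, ⟨b, h⟩, rfl⟩
  · rintro ⟨a, ⟨b, h⟩, rfl⟩
    exact ⟨f b, a, b, h, rfl, rfl⟩

/-- The image of a copy of `H` under a permutation of the vertices of `K_n`. -/
def Copy.perm {k n : ℕ} {H : SimpleGraph (Fin k)} (σ : Equiv.Perm (Fin n)) (c : Copy H n) :
    Copy H n :=
  ⟨c.1.map σ.toEmbedding, by
    obtain ⟨f, hf⟩ := c.2
    exact ⟨f.trans σ.toEmbedding, by rw [hf, SimpleGraph.map_map]; rfl⟩⟩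

lemma Copy.perm_injective {k n : ℕ} {H : SimpleGraph (Fin k)} (σ : Equiv.Perm (Fin n)) :
    Function.Injective (Copy.perm (H := H) σ) := by
  intro c d h
  exact Subtype.ext (SimpleGraph.map_injective σ.toEmbedding (congrArg Subtype.val h))

lemma Copy.perm_mem_copiesAt {k n : ℕ} {H : SimpleGraph (Fin k)} (σ : Equiv.Perm (Fin n))
    {c : Copy H n} {v : Fin n} (h : c ∈ copiesAt H n v) : c.perm σ ∈ copiesAt H n (σ v) := by
  rw [mem_copiesAt] at h ⊢
  exact (mem_support_map _ _ _).2 ⟨v, h, rfl⟩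

lemma card_copiesAt_eq {k n : ℕ} (H : SimpleGraph (Fin k)) (u v : Fin n) :
    (copiesAt H n u).card = (copiesAt H n v).card := by
  have key : ∀ u v : Fin n, (copiesAt H n u).card ≤ (copiesAt H n v).card := fun u v =>
    Finset.card_le_card_of_injOn (Copy.perm (Equiv.swap u v))
      (fun c hc => by simpa using Copy.perm_mem_copiesAt (Equiv.swap u v) hc)
      (Copy.perm_injective _).injOn
  exact le_antisymm (key u v) (key v u)

open Classical in
lemma card_copiesAt_inter_eq {k n : ℕ} (H : SimpleGraph (Fin k)) {u v u' v' : Fin n}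
    (h : u ≠ v) (h' : u' ≠ v') :
    (copiesAt H n u ∩ copiesAt H n v).card = (copiesAt H n u' ∩ copiesAt H n v').card := by
  have key : ∀ {u v u' v' : Fin n}, u ≠ v → u' ≠ v' →
      (copiesAt H n u ∩ copiesAt H n v).card ≤ (copiesAt H n u' ∩ copiesAt H n v').card := by
    intro u v u' v' h h'
    obtain ⟨σ, hu, hv⟩ : ∃ σ : Equiv.Perm (Fin n), σ u = u' ∧ σ v = v' := by
      refine ⟨(Equiv.swap u u').trans (Equiv.swap (Equiv.swap u u' v) v'), ?_, ?_⟩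
      · have : u' ≠ Equiv.swap u u' v := fun e => by
          have := congrArg (Equiv.swap u u') e
          simp at this
          exact h this
        simp [Equiv.swap_apply_of_ne_of_ne this h']
      · simp
    refine Finset.card_le_card_of_injOn (Copy.perm σ) (fun c hc => ?_)
      (Copy.perm_injective _).injOn
    simp only [Finset.coe_inter, Set.mem_inter_iff, Finset.mem_coe] at hc ⊢
    exact ⟨hu ▸ Copy.perm_mem_copiesAt σ hc.1, hv ▸ Copy.perm_mem_copiesAt σ hc.2⟩
  exact le_antisymm (key h h') (key h' h)

lemma mr_one_eq_card_copiesAt {k n : ℕ} (H : SimpleGraph (Fin k)) (v : Fin n) :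
    mr H n 1 = (copiesAt H n v).card := by
  classical
  have hn : 0 < n := v.pos
  rw [card_copiesAt_eq H v ⟨0, hn⟩, mr, copiesAt, ← Fintype.card_subtype,
    ← Nat.card_eq_fintype_card]
  refine Nat.card_congr ?_
  refine (Equiv.subtypeEquivRight fun G => ?_).trans
    (Equiv.subtypeSubtypeEquivSubtypeInter (IsCopy H) (fun G => ⟨0, hn⟩ ∈ G.support)).symm
  refine and_congr_right fun _ => ⟨?_, fun h => ⟨_, h, Nat.zero_lt_one⟩⟩
  rintro ⟨w, hw, hlt⟩
  have : w = ⟨0, hn⟩ := Fin.ext (by simpa using hlt)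
  exact this ▸ hw

open Classical in
lemma card_support_copy {k n : ℕ} {H : SimpleGraph (Fin k)}
    (hiso : ∀ v, (H.neighborSet v).Nonempty) (c : Copy H n) :
    (Finset.univ.filter fun v => v ∈ c.1.support).card = k := by
  obtain ⟨G, f, rfl⟩ := c
  have : (Finset.univ.filter fun v => v ∈ (H.map f).support) = Finset.univ.map f := by
    ext w
    simp only [Finset.mem_filter, Finset.mem_univ, true_and, mem_support_map, Finset.mem_map]
    exact exists_congr fun a => and_iff_right (hiso a)
  simp [this]

open Classical in
/-- Double counting of the pairs of a copy through `u` and another vertex of that copy. -/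
lemma sum_card_copiesAt_inter {k n : ℕ} {H : SimpleGraph (Fin k)}
    (hiso : ∀ v, (H.neighborSet v).Nonempty) (u : Fin n) :
    ∑ v ∈ Finset.univ.erase u, (copiesAt H n u ∩ copiesAt H n v).card =
      (copiesAt H n u).card * (k - 1) := by
  have h1 : ∀ v, (copiesAt H n u ∩ copiesAt H n v).card =
      ((copiesAt H n u).filter fun c => v ∈ c.1.support).card := by
    intro v
    congr 1
    ext c
    simp [mem_copiesAt]
  simp_rw [h1, Finset.card_filter]
  rw [Finset.sum_comm, ← smul_eq_mul]
  refine Finset.sum_eq_card_nsmul fun c hc => ?_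
  rw [← Finset.card_filter, Finset.filter_erase, Finset.card_erase_of_mem, card_support_copy hiso]
  simpa using mem_copiesAt.1 hc

lemma nonempty_copy {k n : ℕ} (H : SimpleGraph (Fin k)) (h : k ≤ n) : Nonempty (Copy H n) :=
  ⟨⟨_, Fin.castLEEmb h, rfl⟩⟩

lemma two_le_of_neighborSet_nonempty {k : ℕ} {H : SimpleGraph (Fin k)} (hk : 0 < k)
    (hiso : ∀ v, (H.neighborSet v).Nonempty) : 2 ≤ k := by
  obtain ⟨w, hw⟩ := hiso ⟨0, hk⟩
  have := H.ne_of_adj hw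
  have : (w : ℕ) ≠ 0 := fun h => this (Fin.ext h.symm)
  omega

lemma copiesAt_nonempty {k n : ℕ} {H : SimpleGraph (Fin k)} (hk : 0 < k) (h : k ≤ n)
    (hiso : ∀ v, (H.neighborSet v).Nonempty) (v : Fin n) : (copiesAt H n v).Nonempty := by
  classical
  obtain ⟨c⟩ := nonempty_copy H h
  have := card_support_copy hiso c
  obtain ⟨w, hw⟩ := Finset.card_pos.1 (this ▸ hk)
  have hc : c ∈ copiesAt H n w := mem_copiesAt.2 (Finset.mem_filter.1 hw).2
  rw [← Finset.card_pos, card_copiesAt_eq H v w]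
  exact Finset.card_pos.2 ⟨c, hc⟩

open Classical in
lemma card_copiesAt_inter_mul {k n : ℕ} {H : SimpleGraph (Fin k)}
    (hiso : ∀ v, (H.neighborSet v).Nonempty) {u v : Fin n} (huv : u ≠ v) :
    (n - 1) * (copiesAt H n u ∩ copiesAt H n v).card = mr H n 1 * (k - 1) := by
  rw [mr_one_eq_card_copiesAt H u, ← sum_card_copiesAt_inter hiso u,
    Finset.sum_const_nat (m := (copiesAt H n u ∩ copiesAt H n v).card)]
  · simp
  · intro w hw
    exact card_copiesAt_inter_eq H (Finset.ne_of_mem_erase hw).symm huv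

/-- The number of copies through a vertex is at least `(n - 1) / (k - 1)`. -/
lemma le_mr_one_mul {k n : ℕ} {H : SimpleGraph (Fin k)} (hk : 0 < k) (h : k ≤ n)
    (hiso : ∀ v, (H.neighborSet v).Nonempty) : n - 1 ≤ mr H n 1 * (k - 1) := by
  classical
  have hk2 := two_le_of_neighborSet_nonempty hk hiso
  let u : Fin n := ⟨0, by omega⟩
  let v : Fin n := ⟨1, by omega⟩
  have huv : u ≠ v := fun e => by simpa [u, v] using congrArg Fin.val e
  have key := card_copiesAt_inter_mul hiso huv
  have hpos : 0 < mr H n 1 * (k - 1) := by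
    refine Nat.mul_pos ?_ (by omega)
    rw [mr_one_eq_card_copiesAt H u]
    exact Finset.card_pos.2 (copiesAt_nonempty hk h hiso u)
  rw [← key] at hpos ⊢
  exact Nat.le_mul_of_pos_right _ (Nat.pos_of_mul_pos_left hpos)

lemma graphOf_neighborSet_eq_empty {k n : ℕ} {H : SimpleGraph (Fin k)} (ω : Copy H n → Bool)
    (v : Fin n) : (graphOf ω).neighborSet v = ∅ ↔ ∀ c ∈ copiesAt H n v, ω c = false := by
  have hadj : ∀ w, (graphOf ω).Adj v w ↔ ∃ c : Copy H n, ω c = true ∧ c.1.Adj v w := by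
    intro w
    rw [graphOf, SimpleGraph.iSup_adj]
    refine exists_congr fun c => ?_
    cases h : ω c <;> simp
  rw [Set.eq_empty_iff_forall_notMem]
  simp only [SimpleGraph.mem_neighborSet, hadj, mem_copiesAt, SimpleGraph.mem_support]
  constructor
  · rintro h c ⟨w, hw⟩
    by_contra hc
    exact h w ⟨c, by simpa using hc, hw⟩
  · rintro h w ⟨c, hc, hw⟩
    simp [h c ⟨w, hw⟩] at hc

/-- The probability weight of a family of selected copies. -/
noncomputable def weight {α : Type*} [Fintype α] (p : ℝ) (ω : α → Bool) : ℝ :=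
  ∏ c, if ω c then p else 1 - p

lemma weight_nonneg {α : Type*} [Fintype α] {p : ℝ} (h0 : 0 ≤ p) (h1 : p ≤ 1) (ω : α → Bool) :
    0 ≤ weight p ω :=
  Finset.prod_nonneg fun c _ => by split_ifs <;> linarith

lemma sum_weight_forall_false {α : Type*} [Fintype α] [DecidableEq α] (p : ℝ) (S : Finset α) :
    ∑ ω : α → Bool, weight p ω * (if ∀ c ∈ S, ω c = false then 1 else 0) =
      (1 - p) ^ S.card := by
  have h : ∀ ω : α → Bool, weight p ω * (if ∀ c ∈ S, ω c = false then 1 else 0) =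
      ∏ c, (if ω c then (if c ∈ S then 0 else p) else 1 - p) := by
    intro ω
    split_ifs with hS
    · rw [mul_one, weight]
      refine Finset.prod_congr rfl fun c _ => ?_
      by_cases hc : c ∈ S
      · simp [hS c hc]
      · simp [hc]
    · push Not at hS
      obtain ⟨c, hc, hω⟩ := hS
      rw [mul_zero]
      exact (Finset.prod_eq_zero (Finset.mem_univ c) (by simp_all)).symm
  simp_rw [h]
  rw [← Fintype.piFinset_univ,
    ← Finset.prod_univ_sum (fun _ => Finset.univ)
      (fun c (b : Bool) => if b then (if c ∈ S then (0 : ℝ) else p) else 1 - p)]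
  have h2 : ∀ c, ∑ b : Bool, (if b then (if c ∈ S then (0 : ℝ) else p) else 1 - p) =
      if c ∈ S then 1 - p else 1 := by
    intro c
    by_cases hc : c ∈ S <;> simp [hc]
  simp_rw [h2]
  simp

lemma sum_weight {α : Type*} [Fintype α] [DecidableEq α] (p : ℝ) :
    ∑ ω : α → Bool, weight p ω = 1 := by
  simpa using sum_weight_forall_false (α := α) p ∅

lemma one_sub_le_one_sub_variance_div {μ L ε : ℝ} (hμ : 0 ≤ μ) (hμL : μ ≤ L) (hL : 0 < L)
    (hε0 : 0 ≤ ε) (hε1 : ε < 1) :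
    1 - (1 / L + ε / (1 - ε)) ≤ 1 - (μ + μ ^ 2 / (1 - ε) - μ ^ 2) / L ^ 2 := by
  have hε' : 0 < 1 - ε := by linarith
  have e : μ + μ ^ 2 / (1 - ε) - μ ^ 2 = μ + μ ^ 2 * (ε / (1 - ε)) := by
    field_simp
    ring
  have e2 : 1 / L + ε / (1 - ε) = (L + L ^ 2 * (ε / (1 - ε))) / L ^ 2 := by
    field_simp
  rw [e, e2]
  gcongr

/-- Chebyshev's upper tail bound for a finite weighted sum. -/
lemma one_sub_le_sum_of_variance {Ω : Type*} [Fintype Ω] (w X : Ω → ℝ) (hw : ∀ ω, 0 ≤ w ω)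
    (hw1 : ∑ ω, w ω = 1) {μ L s : ℝ} (hL : 0 < L) (hμL : μ ≤ L) (hμ : ∑ ω, w ω * X ω = μ)
    (hs : ∑ ω, w ω * X ω ^ 2 ≤ s) (P : Ω → Prop) [DecidablePred P]
    (hP : ∀ ω, X ω ≤ 2 * L → P ω) :
    1 - (s - μ ^ 2) / L ^ 2 ≤ ∑ ω, w ω * (if P ω then 1 else 0) := by
  have hpt : ∀ ω, w ω - w ω * (X ω - μ) ^ 2 / L ^ 2 ≤ w ω * (if P ω then 1 else 0) := by
    intro ω
    split_ifs with h
    · have : 0 ≤ w ω * (X ω - μ) ^ 2 / L ^ 2 := by have := hw ω; positivity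
      linarith
    · have hX : 2 * L < X ω := not_le.1 fun h' => h (hP ω h')
      have : L ^ 2 ≤ (X ω - μ) ^ 2 := pow_le_pow_left₀ hL.le (by linarith) 2
      have : w ω ≤ w ω * (X ω - μ) ^ 2 / L ^ 2 := by
        rw [le_div_iff₀ (by positivity)]
        exact mul_le_mul_of_nonneg_left this (hw ω)
      linarith
  have hsum := Finset.sum_le_sum fun ω (_ : ω ∈ Finset.univ) => hpt ω
  rw [Finset.sum_sub_distrib, hw1, ← Finset.sum_div] at hsum
  have hvar : ∑ ω, w ω * (X ω - μ) ^ 2 = ∑ ω, w ω * X ω ^ 2 - μ ^ 2 := by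
    have : ∀ ω, w ω * (X ω - μ) ^ 2 = w ω * X ω ^ 2 - 2 * μ * (w ω * X ω) + μ ^ 2 * w ω :=
      fun ω => by ring
    simp_rw [this]
    rw [Finset.sum_add_distrib, Finset.sum_sub_distrib, ← Finset.mul_sum, ← Finset.mul_sum,
      hw1, hμ]
    ring
  rw [hvar] at hsum
  refine le_trans ?_ hsum
  gcongr

/-- The number of sets of a family that contain no selected element. -/
noncomputable def avoidedCount {α ι : Type*} [Fintype ι] (A : ι → Finset α) (ω : α → Bool) : ℝ :=
  ∑ v, if ∀ c ∈ A v, ω c = false then 1 else 0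

lemma ncard_isolated_eq_avoidedCount {k n : ℕ} {H : SimpleGraph (Fin k)} (ω : Copy H n → Bool) :
    ({v : Fin n | (graphOf ω).neighborSet v = ∅}.ncard : ℝ) = avoidedCount (copiesAt H n) ω := by
  simp_rw [graphOf_neighborSet_eq_empty]
  rw [Set.ncard_eq_toFinset_card', avoidedCount]
  simp

lemma sum_weight_avoidedCount {α ι : Type*} [Fintype α] [DecidableEq α] [Fintype ι]
    (A : ι → Finset α) (p : ℝ) :
    ∑ ω : α → Bool, weight p ω * avoidedCount A ω = ∑ v, (1 - p) ^ (A v).card := by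
  simp_rw [avoidedCount, Finset.mul_sum]
  rw [Finset.sum_comm]
  refine Finset.sum_congr rfl fun v _ => ?_
  convert sum_weight_forall_false p (A v)

lemma sum_weight_avoidedCount_sq {α ι : Type*} [Fintype α] [DecidableEq α] [Fintype ι]
    (A : ι → Finset α) (p : ℝ) :
    ∑ ω : α → Bool, weight p ω * avoidedCount A ω ^ 2 =
      ∑ u, ∑ v, (1 - p) ^ (A u ∪ A v).card := by
  simp_rw [avoidedCount, sq, Finset.sum_mul_sum, Finset.mul_sum]
  rw [Finset.sum_comm]
  refine Finset.sum_congr rfl fun u _ => ?_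
  rw [Finset.sum_comm]
  refine Finset.sum_congr rfl fun v _ => ?_
  rw [← sum_weight_forall_false]
  refine Finset.sum_congr rfl fun ω _ => ?_
  congr 1
  simp only [Finset.mem_union, or_imp, forall_and]
  split_ifs <;> simp_all

open Classical in
/-- Quasi-independence: two given vertices are simultaneously isolated with probability at most
that of the independent case, up to a factor `1 / (1 - ε)`. -/
lemma pow_card_copiesAt_union_le {k n : ℕ} {H : SimpleGraph (Fin k)}
    (hiso : ∀ v, (H.neighborSet v).Nonempty) (hn : 1 < n) {p ε : ℝ} (h1 : p ≤ 1)
    (hε : p * (mr H n 1 * (k - 1 : ℕ)) ≤ ε * (n - 1 : ℕ)) (hε1 : ε < 1) {u v : Fin n}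
    (huv : u ≠ v) :
    (1 - p) ^ (copiesAt H n u ∪ copiesAt H n v).card ≤ ((1 - p) ^ mr H n 1) ^ 2 / (1 - ε) := by
  have hcard := Finset.card_union_add_card_inter (copiesAt H n u) (copiesAt H n v)
  rw [← mr_one_eq_card_copiesAt, ← mr_one_eq_card_copiesAt] at hcard
  set m := (copiesAt H n u ∩ copiesAt H n v).card with hm
  have key : ((n - 1 : ℕ) : ℝ) * m = mr H n 1 * (k - 1 : ℕ) := by
    exact_mod_cast card_copiesAt_inter_mul hiso huv
  have hn' : (0 : ℝ) < (n - 1 : ℕ) := by exact_mod_cast Nat.sub_pos_of_lt hn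
  have hpm : p * m ≤ ε := by
    rw [← key] at hε
    refine le_of_mul_le_mul_right ?_ hn'
    linarith
  have hb : 1 - ε ≤ (1 - p) ^ m := by
    have := one_add_mul_le_pow (a := -p) (by linarith) m
    rw [← sub_eq_add_neg] at this
    linarith
  rw [le_div_iff₀ (by linarith), ← pow_mul, mul_two, ← hcard, pow_add]
  exact mul_le_mul_of_nonneg_left hb (pow_nonneg (by linarith) _)

open Classical in
lemma motifProb_le_one {k : ℕ} (H : SimpleGraph (Fin k)) (n : ℕ) {p : ℝ} (h0 : 0 ≤ p)
    (h1 : p ≤ 1) (Q : SimpleGraph (Fin n) → Prop) : motifProb H n p Q ≤ 1 := by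
  rw [← sum_weight (α := Copy H n) p, motifProb, selProb]
  refine Finset.sum_le_sum fun ω _ => ?_
  have := weight_nonneg h0 h1 ω
  rw [← weight]
  split_ifs <;> linarith

open Classical in
/-- The second moment bound for the number of isolated vertices. -/
lemma one_sub_le_motifProb_isolated {k n : ℕ} {H : SimpleGraph (Fin k)}
    (hiso : ∀ v, (H.neighborSet v).Nonempty) (hn : 1 < n) {p ε L : ℝ} (h0 : 0 ≤ p)
    (h1 : p ≤ 1) (hε : p * (mr H n 1 * (k - 1 : ℕ)) ≤ ε * (n - 1 : ℕ)) (hε0 : 0 ≤ ε)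
    (hε1 : ε < 1) (hL : 0 < L) (hμ : n * (1 - p) ^ mr H n 1 ≤ L) :
    1 - (1 / L + ε / (1 - ε)) ≤ motifProb H n p
      (fun G => ({v : Fin n | G.neighborSet v = ∅}.ncard : ℝ) ≤ 2 * L) := by
  set q := (1 - p) ^ mr H n 1 with hq
  have hq0 : 0 ≤ q := pow_nonneg (by linarith) _
  have hsq : ∑ u : Fin n, ∑ v : Fin n, (1 - p) ^ (copiesAt H n u ∪ copiesAt H n v).card ≤
      n * q + (n * q) ^ 2 / (1 - ε) := by
    have hpt : ∀ u v : Fin n, (1 - p) ^ (copiesAt H n u ∪ copiesAt H n v).card ≤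
        (if u = v then q else 0) + q ^ 2 / (1 - ε) := by
      intro u v
      have hnn : 0 ≤ q ^ 2 / (1 - ε) := div_nonneg (sq_nonneg _) (by linarith)
      by_cases huv : u = v
      · subst huv
        rw [if_pos rfl, Finset.union_self, ← mr_one_eq_card_copiesAt, ← hq]
        linarith
      · rw [if_neg huv, zero_add]
        exact pow_card_copiesAt_union_le hiso hn h1 hε hε1 huv
    refine (Finset.sum_le_sum fun u _ => Finset.sum_le_sum fun v _ => hpt u v).trans_eq ?_
    simp only [Finset.sum_add_distrib, Finset.sum_ite_eq, Finset.mem_univ, if_true,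
      Finset.sum_const, Finset.card_univ, Fintype.card_fin, nsmul_eq_mul]
    ring
  have hmean : ∑ v : Fin n, (1 - p) ^ (copiesAt H n v).card = n * q := by
    simp_rw [← mr_one_eq_card_copiesAt, ← hq]
    simp
  have hcheb := one_sub_le_sum_of_variance (weight p) (avoidedCount (copiesAt H n))
    (weight_nonneg h0 h1) (sum_weight p) hL hμ
    ((sum_weight_avoidedCount (copiesAt H n) p).trans hmean)
    ((sum_weight_avoidedCount_sq (copiesAt H n) p).trans_le hsq)
    (fun ω => ({v : Fin n | (graphOf ω).neighborSet v = ∅}.ncard : ℝ) ≤ 2 * L)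
    (fun ω h => (ncard_isolated_eq_avoidedCount ω).trans_le h)
  exact (one_sub_le_one_sub_variance_div (by positivity) hμ hL hε0 hε1).trans hcheb

lemma tendsto_log_mul_div_sub_one (a : ℝ) :
    Tendsto (fun n : ℕ => Real.log n * a / (n - 1 : ℕ)) atTop (nhds 0) := by
  have h := ((Real.tendsto_pow_log_div_mul_add_atTop 1 (-1) 1 one_ne_zero).comp
    tendsto_natCast_atTop_atTop).mul_const a
  rw [zero_mul] at h
  refine h.congr' ?_
  filter_upwards [eventually_ge_atTop 1] with n hn
  simp only [Function.comp, pow_one, one_mul, Nat.cast_sub hn, Nat.cast_one]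
  ring

/-- **Lemma (isolated vertices).**  With `p_- = (ln n - ln ln n)/m_1(H)`, w.h.p. the
number of isolated vertices of `G(H,n,p_-)` is at most `2 ln n`. -/
theorem isolated_vertices_bound {k : ℕ} (H : SimpleGraph (Fin k)) (hk : 0 < k)
    (hiso : ∀ v, (H.neighborSet v).Nonempty) :
    Tendsto (fun n => motifProb H n
        ((Real.log n - Real.log (Real.log n)) / (mr H n 1))
        (fun G => ({v : Fin n | G.neighborSet v = ∅}.ncard : ℝ) ≤ 2 * Real.log n))
      atTop (nhds 1) := by
  have hk2 := two_le_of_neighborSet_nonempty hk hiso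
  have hlog : Tendsto (fun n : ℕ => Real.log n) atTop atTop :=
    Real.tendsto_log_atTop.comp tendsto_natCast_atTop_atTop
  have hεlim := tendsto_log_mul_div_sub_one (k - 1 : ℕ)
  set ε : ℕ → ℝ := fun n => Real.log n * (k - 1 : ℕ) / (n - 1 : ℕ) with hε
  have hlow : Tendsto (fun n : ℕ => 1 - (1 / Real.log n + ε n / (1 - ε n))) atTop (nhds 1) := by
    have h1 : Tendsto (fun n : ℕ => 1 / Real.log n) atTop (nhds 0) := by
      simpa only [one_div] using! tendsto_inv_atTop_zero.comp hlog
    have h2 : Tendsto (fun n : ℕ => ε n / (1 - ε n)) atTop (nhds (0 / (1 - 0))) :=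
      hεlim.div (hεlim.const_sub 1) (by norm_num)
    simpa using (h1.add h2).const_sub 1
  have hev : ∀ᶠ n : ℕ in atTop, 1 < n ∧ k ≤ n ∧ 1 ≤ Real.log n ∧ ε n < 1 :=
    (eventually_gt_atTop 1).and ((eventually_ge_atTop k).and
      ((hlog.eventually_ge_atTop 1).and (hεlim.eventually_lt_const one_pos)))
  have hp : ∀ᶠ n : ℕ in atTop,
      0 ≤ (Real.log n - Real.log (Real.log n)) / (mr H n 1) ∧
      (Real.log n - Real.log (Real.log n)) / (mr H n 1) ≤ 1 ∧
      (Real.log n - Real.log (Real.log n)) / (mr H n 1) * (mr H n 1 * (k - 1 : ℕ)) ≤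
        ε n * (n - 1 : ℕ) ∧ 0 ≤ ε n ∧
      n * (1 - (Real.log n - Real.log (Real.log n)) / (mr H n 1)) ^ mr H n 1 ≤ Real.log n := by
    filter_upwards [hev] with n ⟨hn, hkn, hL, hε1⟩
    have hm := le_mr_one_mul hk hkn hiso
    have hmpos : 0 < mr H n 1 := by
      refine Nat.pos_of_ne_zero fun h => ?_
      rw [h, zero_mul] at hm
      omega
    have hm' : ((n - 1 : ℕ) : ℝ) ≤ mr H n 1 * (k - 1 : ℕ) := by exact_mod_cast hm
    have hM : (0 : ℝ) < mr H n 1 := by exact_mod_cast hmpos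
    have hn1 : (0 : ℝ) < (n - 1 : ℕ) := by exact_mod_cast Nat.sub_pos_of_lt hn
    have hn0 : (0 : ℝ) < n := by exact_mod_cast (by omega : 0 < n)
    have hK : (0 : ℝ) < (k - 1 : ℕ) := by exact_mod_cast (by omega : 0 < k - 1)
    set L := Real.log n with hLdef
    have hLL : 0 ≤ Real.log L := Real.log_nonneg hL
    have hLL' : Real.log L ≤ L := Real.log_le_self (by linarith)
    have hεn : ε n * (n - 1 : ℕ) = L * (k - 1 : ℕ) := by
      rw [hε]
      exact div_mul_cancel₀ _ hn1.ne'
    have hLM : L ≤ mr H n 1 := by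
      have : ε n * (n - 1 : ℕ) < 1 * (n - 1 : ℕ) := mul_lt_mul_of_pos_right hε1 hn1
      rw [hεn, one_mul] at this
      exact (lt_of_mul_lt_mul_right (this.trans_le hm') hK.le).le
    have hp1 : (L - Real.log L) / (mr H n 1) ≤ 1 := by
      rw [div_le_one hM]
      linarith
    refine ⟨div_nonneg (by linarith) hM.le, hp1, ?_, by positivity, ?_⟩
    · rw [hεn, ← mul_assoc, div_mul_cancel₀ _ hM.ne']
      exact mul_le_mul_of_nonneg_right (by linarith) hK.le
    · calc (n : ℝ) * (1 - (L - Real.log L) / (mr H n 1)) ^ mr H n 1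
          ≤ n * Real.exp (-(L - Real.log L)) := by
            refine mul_le_mul_of_nonneg_left ?_ hn0.le
            exact Real.one_sub_div_pow_le_exp_neg (by linarith)
        _ = L := by
            rw [neg_sub, Real.exp_sub, Real.exp_log (by linarith), hLdef, Real.exp_log hn0]
            exact mul_div_cancel₀ _ hn0.ne'
  refine tendsto_of_tendsto_of_tendsto_of_le_of_le' hlow tendsto_const_nhds ?_ ?_
  · filter_upwards [hev, hp] with n ⟨hn, _, hL, hε1⟩ ⟨h0, h1, hle, hε0, hμ⟩
    exact one_sub_le_motifProb_isolated hiso hn h0 h1 hle hε0 hε1 (by linarith) hμ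
  · filter_upwards [hp] with n ⟨h0, h1, _⟩
    exact motifProb_le_one H n h0 h1 _

end RandomMotif
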